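/- arXiv:2311.17702 — 9 statements merged into one kernel-verified Lean document; each statement's English description precedes it below -/
import Mathlib

section
/- Let F : ℝⁿ → ℝᵐ be continuously differentiable, ψ(x,d) = max_{1≤i≤m} ⟨∇Fᵢ(x), d⟩, v(x) the unique minimizer over d ∈ ℝⁿ of ψ(x,d) + ½‖d‖², and θ(x) = ψ(x,v(x)) + ½‖v(x)‖² the optimal value. Then for every x ∈ ℝⁿ, θ(x) = −½‖v(x)‖²; equivalently, ψ(x, v(x)) = −‖v(x)‖². -/
open scoped RealInnerProductSpace

noncomputable def psi {n m : ℕ} [NeZero m]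
    (F : Fin m → EuclideanSpace ℝ (Fin n) → ℝ)
    (x d : EuclideanSpace ℝ (Fin n)) : ℝ :=
  Finset.univ.sup' Finset.univ_nonempty fun i => ⟪gradient (F i) x, d⟫

theorem psi_smul_of_nonneg {n m : ℕ} [NeZero m]
    (F : Fin m → EuclideanSpace ℝ (Fin n) → ℝ)
    (x d : EuclideanSpace ℝ (Fin n)) {t : ℝ} (ht : 0 ≤ t) :
    psi F x (t • d) = t * psi F x d := by
  simp only [psi, real_inner_smul_right]
  exact (Finset.mul₀_sup' ht _ _ _).symm

theorem eq_zero_of_forall_nonneg_linear_add_sq {a c : ℝ} (ha : 0 ≤ a)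
    (h : ∀ s : ℝ, -1 ≤ s → 0 ≤ s * c + s ^ 2 * (a / 2)) : c = 0 := by
  have hD : 0 < a + |c| + 1 := by positivity
  have hs : -1 ≤ -c / (a + |c| + 1) := by
    rw [le_div_iff₀ hD]
    linarith [le_abs_self c]
  have key := h _ hs
  have heq : -c / (a + |c| + 1) * c + (-c / (a + |c| + 1)) ^ 2 * (a / 2) =
      -(c ^ 2 * (a / 2 + |c| + 1)) / (a + |c| + 1) ^ 2 := by
    field_simp
    ring
  rw [heq] at key
  by_contra hc
  have : 0 < c ^ 2 * (a / 2 + |c| + 1) := by positivity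
  exact absurd key (not_le.mpr (div_neg_of_neg_of_pos (by linarith) (by positivity)))

theorem stmt4 {n m : ℕ} [NeZero m]
    (F : Fin m → EuclideanSpace ℝ (Fin n) → ℝ)
    (hF : ∀ i, ContDiff ℝ 1 (F i))
    (v : EuclideanSpace ℝ (Fin n) → EuclideanSpace ℝ (Fin n))
    (hv : ∀ x d, psi F x (v x) + ‖v x‖ ^ 2 / 2 ≤ psi F x d + ‖d‖ ^ 2 / 2)
    (x : EuclideanSpace ℝ (Fin n)) :
    psi F x (v x) + ‖v x‖ ^ 2 / 2 = -(‖v x‖ ^ 2 / 2) ∧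
    psi F x (v x) = -‖v x‖ ^ 2 := by
  have hzero : psi F x (v x) + ‖v x‖ ^ 2 = 0 := by
    refine eq_zero_of_forall_nonneg_linear_add_sq (sq_nonneg ‖v x‖) fun s hs => ?_
    have h := hv x ((1 + s) • v x)
    rw [psi_smul_of_nonneg F x (v x) (by linarith), norm_smul, mul_pow, Real.norm_eq_abs,
      sq_abs] at h
    linarith
  constructor <;> linarith
end

section
/- Let F : ℝⁿ → ℝᵐ be continuously differentiable, ψ(x,d) = max_{1≤i≤m} ⟨∇Fᵢ(x), d⟩, and v(x) the unique minimizer over d ∈ ℝⁿ of ψ(x,d) + ½‖d‖². Then for every x ∈ ℝⁿ there exists λ = (λ₁,…,λₘ) in the standard simplex Δₘ (λᵢ ≥ 0, Σᵢ λᵢ = 1) such that v(x) = −Σ_{i=1}^m λᵢ ∇Fᵢ(x) and λ minimizes the function μ ↦ ½‖Σ_{i=1}^m μᵢ ∇Fᵢ(x)‖² over Δₘ; consequently ψ(x,v(x)) + ½‖v(x)‖² = −½‖Σ_{i=1}^m λᵢ ∇Fᵢ(x)‖². -/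
open scoped RealInnerProductSpace

/-- A finite family of vectors has a convex combination whose inner product with every other convex
combination is at least its squared norm. -/
theorem exists_mem_stdSimplex_norm_sq_le_inner {ι E : Type*} [Fintype ι] [Nonempty ι]
    [NormedAddCommGroup E] [InnerProductSpace ℝ E] (g : ι → E) :
    ∃ lam ∈ stdSimplex ℝ ι, ∀ mu ∈ stdSimplex ℝ ι,
      ‖∑ i, lam i • g i‖ ^ 2 ≤ ⟪∑ i, lam i • g i, ∑ i, mu i • g i⟫ := by
  classical
  let L : (ι → ℝ) →ₗ[ℝ] E := Fintype.linearCombination ℝ g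
  have hL : ∀ mu, L mu = ∑ i, mu i • g i := fun mu => Fintype.linearCombination_apply ℝ g mu
  have hcont : Continuous L := by
    rw [funext hL]
    fun_prop
  have hconv : Convex ℝ (L '' stdSimplex ℝ ι) := (convex_stdSimplex ℝ ι).linear_image L
  have hne : (L '' stdSimplex ℝ ι).Nonempty :=
    ⟨_, Set.mem_image_of_mem L (single_mem_stdSimplex ℝ (Classical.arbitrary ι))⟩
  obtain ⟨w, ⟨lam, hlam, rfl⟩, hw⟩ := exists_norm_eq_iInf_of_complete_convex hne
    ((isCompact_stdSimplex ℝ ι).image hcont).isComplete hconv 0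
  refine ⟨lam, hlam, fun mu hmu => ?_⟩
  have h := (norm_eq_iInf_iff_real_inner_le_zero hconv (Set.mem_image_of_mem L hlam)).1 hw
    (L mu) (Set.mem_image_of_mem L hmu)
  rw [zero_sub, inner_neg_left, inner_sub_right, real_inner_self_eq_norm_sq] at h
  rw [← hL, ← hL]
  linarith

/-- Every convex combination of the gradients bounds `psi` from below. -/
theorem inner_sum_smul_gradient_le_psi {n m : ℕ} [NeZero m]
    (F : Fin m → EuclideanSpace ℝ (Fin n) → ℝ) {lam : Fin m → ℝ}
    (hlam : lam ∈ stdSimplex ℝ (Fin m)) (x d : EuclideanSpace ℝ (Fin n)) :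
    ⟪∑ i, lam i • gradient (F i) x, d⟫ ≤ psi F x d := by
  simp_rw [sum_inner, real_inner_smul_left]
  calc ∑ i, lam i * ⟪gradient (F i) x, d⟫
      ≤ ∑ i, lam i * psi F x d := Finset.sum_le_sum fun i _ =>
        mul_le_mul_of_nonneg_left
          (Finset.le_sup' (fun i => ⟪gradient (F i) x, d⟫) (Finset.mem_univ i)) (hlam.1 i)
    _ = psi F x d := by rw [← Finset.sum_mul, hlam.2, one_mul]

theorem stmt5 {n m : ℕ} [NeZero m]
    (F : Fin m → EuclideanSpace ℝ (Fin n) → ℝ)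
    (hF : ∀ i, ContDiff ℝ 1 (F i))
    (v : EuclideanSpace ℝ (Fin n) → EuclideanSpace ℝ (Fin n))
    (hv : ∀ x d, psi F x (v x) + ‖v x‖ ^ 2 / 2 ≤ psi F x d + ‖d‖ ^ 2 / 2)
    (x : EuclideanSpace ℝ (Fin n)) :
    ∃ lam : Fin m → ℝ, (∀ i, 0 ≤ lam i) ∧ (∑ i, lam i = 1) ∧
      v x = -∑ i, lam i • gradient (F i) x ∧
      (∀ mu : Fin m → ℝ, (∀ i, 0 ≤ mu i) → ∑ i, mu i = 1 →
        (1 / 2) * ‖∑ i, lam i • gradient (F i) x‖ ^ 2 ≤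
          (1 / 2) * ‖∑ i, mu i • gradient (F i) x‖ ^ 2) ∧
      psi F x (v x) + ‖v x‖ ^ 2 / 2 =
        -((1 / 2) * ‖∑ i, lam i • gradient (F i) x‖ ^ 2) := by
  classical
  obtain ⟨lam, hlam, hmin⟩ := exists_mem_stdSimplex_norm_sq_le_inner fun i => gradient (F i) x
  have hlower := inner_sum_smul_gradient_le_psi F hlam x (v x)
  set w := ∑ i, lam i • gradient (F i) x
  have hdescent : psi F x (-w) ≤ -‖w‖ ^ 2 := by
    refine Finset.sup'_le _ _ fun i _ => ?_
    have h := hmin (Pi.single i 1) (single_mem_stdSimplex ℝ i)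
    simp only [Pi.single_apply, ite_smul, one_smul, zero_smul, Finset.sum_ite_eq',
      Finset.mem_univ, if_true] at h
    rw [inner_neg_right, real_inner_comm]
    exact neg_le_neg h
  have hopt := hv x (-w)
  rw [norm_neg] at hopt
  have hexpand := norm_add_sq_real w (v x)
  have hzero : w + v x = 0 := by
    rw [← norm_eq_zero, ← sq_eq_zero_iff]
    exact le_antisymm (by linarith) (sq_nonneg _)
  refine ⟨lam, hlam.1, hlam.2, eq_neg_of_add_eq_zero_right hzero, fun mu hmu hsum => ?_, ?_⟩
  · have h := hmin mu ⟨hmu, hsum⟩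
    have hsq := norm_sub_sq_real w (∑ i, mu i • gradient (F i) x)
    linarith [sq_nonneg ‖w - ∑ i, mu i • gradient (F i) x‖]
  · linarith [sq_nonneg ‖w + v x‖]
end

section
/- Let F : ℝⁿ → ℝᵐ be continuously differentiable, ψ(x,d) = max_{1≤i≤m} ⟨∇Fᵢ(x), d⟩, v(x) the unique minimizer over d ∈ ℝⁿ of ψ(x,d) + ½‖d‖², and θ(x) = ψ(x,v(x)) + ½‖v(x)‖². If x is not Pareto critical, i.e. there exists d ∈ ℝⁿ with ψ(x,d) < 0, then v(x) ≠ 0, θ(x) < 0, and ψ(x, v(x)) < −‖v(x)‖²/2 < 0. -/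
open scoped RealInnerProductSpace

theorem psi_zero {n m : ℕ} [NeZero m] (F : Fin m → EuclideanSpace ℝ (Fin n) → ℝ)
    (x : EuclideanSpace ℝ (Fin n)) : psi F x 0 = 0 := by
  simp [psi]

theorem psi_smul_le {n m : ℕ} [NeZero m] (F : Fin m → EuclideanSpace ℝ (Fin n) → ℝ)
    (x d : EuclideanSpace ℝ (Fin n)) {t : ℝ} (ht : 0 ≤ t) :
    psi F x (t • d) ≤ t * psi F x d := by
  refine Finset.sup'_le _ _ fun i _ => ?_
  rw [real_inner_smul_right]
  exact mul_le_mul_of_nonneg_left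
    (Finset.le_sup' (fun i => ⟪gradient (F i) x, d⟫) (Finset.mem_univ i)) ht

/-- A descent direction, suitably scaled, makes the regularized objective negative. -/
theorem exists_psi_add_sq_norm_neg {n m : ℕ} [NeZero m]
    (F : Fin m → EuclideanSpace ℝ (Fin n) → ℝ) {x d : EuclideanSpace ℝ (Fin n)}
    (hd : psi F x d < 0) : ∃ e, psi F x e + ‖e‖ ^ 2 / 2 < 0 := by
  have hN : 0 < 1 + ‖d‖ ^ 2 := by positivity
  set t : ℝ := -psi F x d / (1 + ‖d‖ ^ 2) with ht
  have htpos : 0 < t := div_pos (neg_pos.mpr hd) hN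
  have hpsi : psi F x d = -(t * (1 + ‖d‖ ^ 2)) := by
    rw [ht]
    field_simp
  refine ⟨t • d, ?_⟩
  have hle := psi_smul_le F x d htpos.le
  rw [hpsi] at hle
  rw [norm_smul, Real.norm_of_nonneg htpos.le]
  nlinarith [sq_nonneg (t * ‖d‖), pow_pos htpos 2]

theorem stmt7 {n m : ℕ} [NeZero m]
    (F : Fin m → EuclideanSpace ℝ (Fin n) → ℝ)
    (hF : ∀ i, ContDiff ℝ 1 (F i))
    (v : EuclideanSpace ℝ (Fin n) → EuclideanSpace ℝ (Fin n))
    (hv : ∀ x d, psi F x (v x) + ‖v x‖ ^ 2 / 2 ≤ psi F x d + ‖d‖ ^ 2 / 2)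
    (x : EuclideanSpace ℝ (Fin n))
    (hncrit : ∃ d, psi F x d < 0) :
    v x ≠ 0 ∧ psi F x (v x) + ‖v x‖ ^ 2 / 2 < 0 ∧
      psi F x (v x) < -‖v x‖ ^ 2 / 2 ∧ -‖v x‖ ^ 2 / 2 < 0 := by
  obtain ⟨d, hd⟩ := hncrit
  obtain ⟨e, he⟩ := exists_psi_add_sq_norm_neg F hd
  have hθ : psi F x (v x) + ‖v x‖ ^ 2 / 2 < 0 := (hv x e).trans_lt he
  have hne : v x ≠ 0 := by
    intro h
    simp [h, psi_zero] at hθ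
  have hpos : 0 < ‖v x‖ ^ 2 := pow_pos (norm_pos_iff.mpr hne) 2
  exact ⟨hne, hθ, by linarith, by linarith⟩
end

section
/- Let F : ℝⁿ → ℝᵐ be continuously differentiable, ψ(x,d) = max_{1≤i≤m} ⟨∇Fᵢ(x), d⟩, and v(x) the unique minimizer over d ∈ ℝⁿ of ψ(x,d) + ½‖d‖². Then the map x ↦ v(x) is continuous on ℝⁿ. -/
open scoped RealInnerProductSpace

theorem ContDiff.continuous_gradient {E : Type*} [NormedAddCommGroup E] [InnerProductSpace ℝ E]
    [CompleteSpace E] {f : E → ℝ} (hf : ContDiff ℝ 1 f) : Continuous (gradient f) :=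
  (InnerProductSpace.toDual ℝ E).symm.continuous.comp (hf.continuous_fderiv one_ne_zero)

theorem psi_midpoint_le {n m : ℕ} [NeZero m]
    (F : Fin m → EuclideanSpace ℝ (Fin n) → ℝ) (x a b : EuclideanSpace ℝ (Fin n)) :
    psi F x ((1 / 2 : ℝ) • (a + b)) ≤ (psi F x a + psi F x b) / 2 := by
  refine Finset.sup'_le _ _ fun i hi => ?_
  have ha : ⟪gradient (F i) x, a⟫ ≤ psi F x a :=
    Finset.le_sup' (fun i => ⟪gradient (F i) x, a⟫) hi
  have hb : ⟪gradient (F i) x, b⟫ ≤ psi F x b :=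
    Finset.le_sup' (fun i => ⟪gradient (F i) x, b⟫) hi
  rw [inner_smul_right, inner_add_right]
  linarith

theorem psi_le_psi_add {n m : ℕ} [NeZero m]
    (F : Fin m → EuclideanSpace ℝ (Fin n) → ℝ) (x y d : EuclideanSpace ℝ (Fin n)) :
    psi F x d ≤ psi F y d + (∑ i, ‖gradient (F i) x - gradient (F i) y‖) * ‖d‖ := by
  refine Finset.sup'_le _ _ fun i hi => ?_
  have hy : ⟪gradient (F i) y, d⟫ ≤ psi F y d :=
    Finset.le_sup' (fun i => ⟪gradient (F i) y, d⟫) hi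
  have hxy := real_inner_le_norm (gradient (F i) x - gradient (F i) y) d
  rw [inner_sub_left] at hxy
  have hsum : ‖gradient (F i) x - gradient (F i) y‖
      ≤ ∑ i, ‖gradient (F i) x - gradient (F i) y‖ :=
    Finset.single_le_sum (f := fun i => ‖gradient (F i) x - gradient (F i) y‖)
      (fun _ _ => norm_nonneg _) hi
  have := mul_le_mul_of_nonneg_right hsum (norm_nonneg d)
  linarith

/-- Quadratic growth of `d ↦ ψ(x, d) + ‖d‖² / 2` around a minimizer. -/
theorem psi_quadratic_growth {n m : ℕ} [NeZero m]
    {F : Fin m → EuclideanSpace ℝ (Fin n) → ℝ} {x u : EuclideanSpace ℝ (Fin n)}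
    (hu : ∀ d, psi F x u + ‖u‖ ^ 2 / 2 ≤ psi F x d + ‖d‖ ^ 2 / 2)
    (d : EuclideanSpace ℝ (Fin n)) :
    psi F x u + ‖u‖ ^ 2 / 2 + ‖d - u‖ ^ 2 / 4 ≤ psi F x d + ‖d‖ ^ 2 / 2 := by
  have hmin := hu ((1 / 2 : ℝ) • (d + u))
  have hmid := psi_midpoint_le F x d u
  have hpar := parallelogram_law_with_norm ℝ d u
  rw [norm_smul, mul_pow, Real.norm_of_nonneg (by norm_num)] at hmin
  linarith

theorem norm_sub_sq_le_of_psi_minimizers {n m : ℕ} [NeZero m]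
    {F : Fin m → EuclideanSpace ℝ (Fin n) → ℝ} {x y u w : EuclideanSpace ℝ (Fin n)}
    (hu : ∀ d, psi F x u + ‖u‖ ^ 2 / 2 ≤ psi F x d + ‖d‖ ^ 2 / 2)
    (hw : ∀ d, psi F y w + ‖w‖ ^ 2 / 2 ≤ psi F y d + ‖d‖ ^ 2 / 2) :
    ‖w - u‖ ^ 2 ≤ 8 * ‖u‖ * (∑ i, ‖gradient (F i) y - gradient (F i) x‖)
      + 4 * (∑ i, ‖gradient (F i) y - gradient (F i) x‖) ^ 2 := by
  have h1 := psi_quadratic_growth hu w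
  have h2 := psi_quadratic_growth hw u
  have h3 := psi_le_psi_add F x y w
  have h4 := psi_le_psi_add F y x u
  simp only [norm_sub_rev (gradient (F _) x)] at h3
  rw [norm_sub_rev u w] at h2
  have hδ : 0 ≤ ∑ i, ‖gradient (F i) y - gradient (F i) x‖ := by positivity
  generalize ∑ i, ‖gradient (F i) y - gradient (F i) x‖ = δ at *
  have h5 : ‖w‖ ≤ ‖u‖ + ‖w - u‖ := norm_le_insert' w u
  have h6 := mul_le_mul_of_nonneg_left h5 hδ
  nlinarith [sq_nonneg (‖w - u‖ - 2 * δ)]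

theorem stmt8 {n m : ℕ} [NeZero m]
    (F : Fin m → EuclideanSpace ℝ (Fin n) → ℝ)
    (hF : ∀ i, ContDiff ℝ 1 (F i))
    (v : EuclideanSpace ℝ (Fin n) → EuclideanSpace ℝ (Fin n))
    (hv : ∀ x d, psi F x (v x) + ‖v x‖ ^ 2 / 2 ≤ psi F x d + ‖d‖ ^ 2 / 2) :
    Continuous v := by
  refine continuous_iff_continuousAt.2 fun x => tendsto_iff_norm_sub_tendsto_zero.2 ?_
  have hg : ∀ i, Continuous (gradient (F i)) := fun i => (hF i).continuous_gradient
  have hbound : Continuous fun y => √(8 * ‖v x‖ * (∑ i, ‖gradient (F i) y - gradient (F i) x‖)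
      + 4 * (∑ i, ‖gradient (F i) y - gradient (F i) x‖) ^ 2) := by
    fun_prop
  refine squeeze_zero (fun _ => norm_nonneg _)
    (fun y => Real.le_sqrt_of_sq_le (norm_sub_sq_le_of_psi_minimizers (hv x) (hv y))) ?_
  simpa using hbound.tendsto x
end

section
/- Let F : ℝⁿ → ℝᵐ be continuously differentiable and ψ(x,d) = max_{1≤i≤m} ⟨∇Fᵢ(x), d⟩. Fix x, d ∈ ℝⁿ with ψ(x,d) < 0 and ρ ∈ (0,1). Then there exists ᾱ > 0 such that for every α ∈ (0, ᾱ] and every i ∈ {1,…,m}, Fᵢ(x + α d) ≤ Fᵢ(x) + ρ α ψ(x,d). (In particular, an Armijo-type step size exists whenever d is a descent direction at a non-Pareto-critical point.) -/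
open scoped RealInnerProductSpace

open Set Filter Topology in
/-- Armijo's condition: a slope `c` strictly above the directional derivative bounds the increments
of `f` along `d` for all sufficiently small positive steps. -/
theorem HasGradientAt.eventually_add_smul_le {E : Type*} [NormedAddCommGroup E]
    [InnerProductSpace ℝ E] [CompleteSpace E] {f : E → ℝ} {x g d : E} {c : ℝ}
    (hf : HasGradientAt f g x) (hc : ⟪g, d⟫ < c) :
    ∀ᶠ α in 𝓝[>] (0 : ℝ), f (x + α • d) ≤ f x + α * c := by
  have hderiv : HasDerivAt (fun α : ℝ => f (x + α • d)) ⟪g, d⟫ 0 := by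
    simpa [HasLineDerivAt] using hf.hasFDerivAt.hasLineDerivAt d
  filter_upwards [hderiv.hasDerivWithinAt.limsup_slope_le' self_notMem_Ioi hc,
    self_mem_nhdsWithin] with α hslope hα
  rw [slope_def_field, div_lt_iff₀ (by simpa using hα)] at hslope
  simp only [zero_smul, add_zero, sub_zero] at hslope
  linarith

theorem stmt9 {n m : ℕ} [NeZero m]
    (F : Fin m → EuclideanSpace ℝ (Fin n) → ℝ)
    (hF : ∀ i, ContDiff ℝ 1 (F i))
    (x d : EuclideanSpace ℝ (Fin n)) (hd : psi F x d < 0)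
    (ρ : ℝ) (hρ : ρ ∈ Set.Ioo (0 : ℝ) 1) :
    ∃ ᾱ > (0 : ℝ), ∀ α : ℝ, 0 < α → α ≤ ᾱ → ∀ i,
      F i (x + α • d) ≤ F i x + ρ * α * psi F x d := by
  have hslope : psi F x d < ρ * psi F x d := by nlinarith [hρ.2]
  have hev : ∀ᶠ α in nhdsWithin (0 : ℝ) (Set.Ioi 0), ∀ i,
      F i (x + α • d) ≤ F i x + α * (ρ * psi F x d) := by
    refine Filter.eventually_all.2 fun i => ?_
    have hgrad : HasGradientAt (F i) (gradient (F i) x) x :=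
      ((hF i).differentiable one_ne_zero x).hasGradientAt
    have hle : ⟪gradient (F i) x, d⟫ ≤ psi F x d :=
      Finset.le_sup' (fun i => ⟪gradient (F i) x, d⟫) (Finset.mem_univ i)
    exact hgrad.eventually_add_smul_le (hle.trans_lt hslope)
  obtain ⟨ᾱ, hᾱ, hsub⟩ := mem_nhdsGT_iff_exists_Ioc_subset.1 hev
  refine ⟨ᾱ, hᾱ, fun α hα hαᾱ i => ?_⟩
  have h : F i (x + α • d) ≤ F i x + α * (ρ * psi F x d) := hsub ⟨hα, hαᾱ⟩ i
  linarith
end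

section
/- Let F : ℝⁿ → ℝᵐ be continuously differentiable and ψ(x,d) = max_{1≤i≤m} ⟨∇Fᵢ(x), d⟩. Let (xₖ) ⊆ ℝⁿ, (dₖ) ⊆ ℝⁿ, (αₖ) ⊆ (0,∞), ρ ∈ (0,1), ηₖ ∈ [0,1], and let (Qₖ) ⊆ ℝ and (Cₖ) ⊆ ℝᵐ satisfy Q₀ = 1, C₀ = F(x₀), Q_{k+1} = ηₖ Qₖ + 1, and C_{k+1,i} = (ηₖ Qₖ C_{k,i} + Fᵢ(x_{k+1}))/Q_{k+1} for all i. Suppose for every k: ψ(xₖ,dₖ) < 0 and Fᵢ(x_{k+1}) ≤ C_{k,i} + ρ αₖ ψ(xₖ,dₖ) for all i. Then for every k and every i, Fᵢ(xₖ) ≤ C_{k,i} ≤ A_{k,i}, where A_{k,i} = (1/(k+1)) Σ_{j=0}^{k} Fᵢ(x_j). -/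
open scoped RealInnerProductSpace

/-- Decreasing the weight `t` on the larger value `c` decreases the weighted mean of `c` and `f`. -/
theorem weighted_mean_le_of_le {c f t s : ℝ} (ht : 0 ≤ t) (hts : t ≤ s) (hf : f ≤ c) :
    (t * c + f) / (t + 1) ≤ (s * c + f) / (s + 1) := by
  rw [div_le_div_iff₀ (by linarith) (by linarith)]
  nlinarith [mul_nonneg (sub_nonneg.2 hf) (sub_nonneg.2 hts)]

theorem stmt10 {n m : ℕ} [NeZero m]
    (F : Fin m → EuclideanSpace ℝ (Fin n) → ℝ)
    (hF : ∀ i, ContDiff ℝ 1 (F i))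
    (x d : ℕ → EuclideanSpace ℝ (Fin n)) (α : ℕ → ℝ) (hα : ∀ k, 0 < α k)
    (ρ : ℝ) (hρ : ρ ∈ Set.Ioo (0 : ℝ) 1)
    (η : ℕ → ℝ) (hη : ∀ k, η k ∈ Set.Icc (0 : ℝ) 1)
    (Q : ℕ → ℝ) (C : ℕ → Fin m → ℝ)
    (hQ0 : Q 0 = 1) (hC0 : ∀ i, C 0 i = F i (x 0))
    (hQ : ∀ k, Q (k + 1) = η k * Q k + 1)
    (hC : ∀ k i, C (k + 1) i = (η k * Q k * C k i + F i (x (k + 1))) / Q (k + 1))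
    (hdesc : ∀ k, psi F (x k) (d k) < 0)
    (hArm : ∀ k i, F i (x (k + 1)) ≤ C k i + ρ * α k * psi F (x k) (d k)) :
    ∀ k i, F i (x k) ≤ C k i ∧
      C k i ≤ (∑ j ∈ Finset.range (k + 1), F i (x j)) / (k + 1) := by
  have hQ_bounds : ∀ k, 0 ≤ Q k ∧ Q k ≤ k + 1 := by
    intro k
    induction k with
    | zero => simp [hQ0]
    | succ k ih =>
      have hle := mul_le_of_le_one_left ih.1 (hη k).2
      have hnonneg := mul_nonneg (hη k).1 ih.1
      rw [hQ]
      push_cast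
      constructor <;> linarith [ih.2]
  have hF_le : ∀ k i, F i (x (k + 1)) ≤ C k i := fun k i => by
    have := mul_neg_of_pos_of_neg (mul_pos hρ.1 (hα k)) (hdesc k)
    linarith [hArm k i]
  intro k i
  induction k with
  | zero => simp [hC0]
  | succ k ih =>
    have ht : 0 ≤ η k * Q k := mul_nonneg (hη k).1 (hQ_bounds k).1
    have hts : η k * Q k ≤ k + 1 :=
      (mul_le_of_le_one_left (hQ_bounds k).1 (hη k).2).trans (hQ_bounds k).2
    have hk : (0 : ℝ) < k + 1 := by positivity
    rw [hC, hQ]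
    constructor
    · rw [le_div_iff₀ (by linarith)]
      nlinarith [mul_le_mul_of_nonneg_left (hF_le k i) ht]
    · refine (weighted_mean_le_of_le ht hts (hF_le k i)).trans ?_
      have hsum := (le_div_iff₀ hk).1 ih.2
      rw [Finset.sum_range_succ _ (k + 1)]
      push_cast
      gcongr
      linarith
end

section
/- Let F : ℝⁿ → ℝᵐ be continuously differentiable and ψ(x,d) = max_{1≤i≤m} ⟨∇Fᵢ(x), d⟩. Let (xₖ), (dₖ), (αₖ), ρ ∈ (0,1), ηₖ ∈ [0,1], and (Qₖ), (Cₖ) be as in the average-type scheme: Q₀ = 1, C₀ = F(x₀), Q_{k+1} = ηₖ Qₖ + 1, C_{k+1,i} = (ηₖ Qₖ C_{k,i} + Fᵢ(x_{k+1}))/Q_{k+1}. Suppose for every k: αₖ > 0, ψ(xₖ,dₖ) < 0, and Fᵢ(x_{k+1}) ≤ C_{k,i} + ρ αₖ ψ(xₖ,dₖ) for all i; suppose also each Fᵢ is bounded from below. Then for each i the sequence (C_{k,i}) is nonincreasing and converges to a finite limit as k → ∞. -/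
open scoped RealInnerProductSpace

theorem stmt12 {n m : ℕ} [NeZero m]
    (F : Fin m → EuclideanSpace ℝ (Fin n) → ℝ)
    (hF : ∀ i, ContDiff ℝ 1 (F i))
    (hbdd : ∀ i, BddBelow (Set.range (F i)))
    (x d : ℕ → EuclideanSpace ℝ (Fin n)) (α : ℕ → ℝ) (hα : ∀ k, 0 < α k)
    (ρ : ℝ) (hρ : ρ ∈ Set.Ioo (0 : ℝ) 1)
    (η : ℕ → ℝ) (hη : ∀ k, η k ∈ Set.Icc (0 : ℝ) 1)
    (Q : ℕ → ℝ) (C : ℕ → Fin m → ℝ)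
    (hQ0 : Q 0 = 1) (hC0 : ∀ i, C 0 i = F i (x 0))
    (hQ : ∀ k, Q (k + 1) = η k * Q k + 1)
    (hC : ∀ k i, C (k + 1) i = (η k * Q k * C k i + F i (x (k + 1))) / Q (k + 1))
    (hdesc : ∀ k, psi F (x k) (d k) < 0)
    (hArm : ∀ k i, F i (x (k + 1)) ≤ C k i + ρ * α k * psi F (x k) (d k)) :
    ∀ i, Antitone (fun k => C k i) ∧
      ∃ l : ℝ, Filter.Tendsto (fun k => C k i) Filter.atTop (nhds l) := by
  have hQpos : ∀ k, 0 < Q k := by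
    intro k
    induction k with
    | zero => rw [hQ0]; exact one_pos
    | succ k ih => rw [hQ k]; nlinarith [mul_nonneg (hη k).1 ih.le]
  have hFC : ∀ k i, F i (x (k + 1)) ≤ C k i := fun k i => by
    linarith [hArm k i, mul_neg_of_pos_of_neg (mul_pos hρ.1 (hα k)) (hdesc k)]
  intro i
  have hanti : Antitone fun k => C k i := by
    refine antitone_nat_of_succ_le fun k => ?_
    rw [hC k i, div_le_iff₀ (hQpos (k + 1)), hQ k]
    linarith [hFC k i]
  have hbelow : BddBelow (Set.range fun k => C k i) := by
    obtain ⟨b, hb⟩ := hbdd i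
    refine ⟨b, ?_⟩
    rintro _ ⟨k, rfl⟩
    exact (hb ⟨x (k + 1), rfl⟩).trans (hFC k i)
  exact ⟨hanti, _, tendsto_atTop_ciInf hanti hbelow⟩
end

section
/- Let F : ℝⁿ → ℝᵐ be continuously differentiable and ψ(x,d) = max_{1≤i≤m} ⟨∇Fᵢ(x), d⟩. Let (xₖ), (dₖ) with dₖ ≠ 0, (Qₖ), (Cₖ), ηₖ ∈ [0,1] satisfy Q₀ = 1, C₀ = F(x₀), Q_{k+1} = ηₖ Qₖ + 1, C_{k+1,i} = (ηₖ Qₖ C_{k,i} + Fᵢ(x_{k+1}))/Q_{k+1}. Suppose there exists ω > 0 such that for all k and all i, C_{k,i} − Fᵢ(x_{k+1}) ≥ ω · ψ(xₖ,dₖ)²/‖dₖ‖², and suppose each Fᵢ is bounded from below. Then the series Σ_{k≥0} (1/Q_{k+1}) · ψ(xₖ,dₖ)²/‖dₖ‖² converges (is finite). -/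
open scoped RealInnerProductSpace

/-- A nonnegative sequence dominated, up to a positive factor, by the successive decreases of a
sequence bounded from below is summable. -/
theorem summable_of_mul_le_sub_succ {a c : ℕ → ℝ} {ω L : ℝ} (hω : 0 < ω) (ha : ∀ k, 0 ≤ a k)
    (hL : ∀ k, L ≤ c k) (h : ∀ k, ω * a k ≤ c k - c (k + 1)) : Summable a := by
  refine summable_of_sum_range_le (c := (c 0 - L) / ω) ha fun N => ?_
  rw [le_div_iff₀' hω, Finset.mul_sum]
  calc ∑ k ∈ Finset.range N, ω * a k
      ≤ ∑ k ∈ Finset.range N, (c k - c (k + 1)) := Finset.sum_le_sum fun k _ => h k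
    _ = c 0 - c N := Finset.sum_range_sub' c N
    _ ≤ c 0 - L := sub_le_sub_left (hL N) _

theorem stmt15 {n m : ℕ} [NeZero m]
    (F : Fin m → EuclideanSpace ℝ (Fin n) → ℝ)
    (hF : ∀ i, ContDiff ℝ 1 (F i))
    (hbdd : ∀ i, BddBelow (Set.range (F i)))
    (x d : ℕ → EuclideanSpace ℝ (Fin n)) (hd : ∀ k, d k ≠ 0)
    (η : ℕ → ℝ) (hη : ∀ k, η k ∈ Set.Icc (0 : ℝ) 1)
    (Q : ℕ → ℝ) (C : ℕ → Fin m → ℝ)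
    (hQ0 : Q 0 = 1) (hC0 : ∀ i, C 0 i = F i (x 0))
    (hQ : ∀ k, Q (k + 1) = η k * Q k + 1)
    (hC : ∀ k i, C (k + 1) i = (η k * Q k * C k i + F i (x (k + 1))) / Q (k + 1))
    (ω : ℝ) (hω : 0 < ω)
    (hdec : ∀ k i, C k i - F i (x (k + 1)) ≥ ω * (psi F (x k) (d k)) ^ 2 / ‖d k‖ ^ 2) :
    Summable (fun k => (1 / Q (k + 1)) * ((psi F (x k) (d k)) ^ 2 / ‖d k‖ ^ 2)) := by
  have hQ1 : ∀ k, 1 ≤ Q k := by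
    intro k
    induction k with
    | zero => exact hQ0.ge
    | succ k ih => nlinarith [hQ k, mul_nonneg (hη k).1 (zero_le_one.trans ih)]
  have hQpos : ∀ k, 0 < Q k := fun k => zero_lt_one.trans_le (hQ1 k)
  obtain ⟨L, hL⟩ := hbdd 0
  have hFL : ∀ y, L ≤ F 0 y := fun y => hL ⟨y, rfl⟩
  have hCL : ∀ k, L ≤ C k 0 := by
    intro k
    induction k with
    | zero => exact (hC0 0).symm ▸ hFL (x 0)
    | succ k ih =>
      rw [hC, le_div_iff₀ (hQpos _), hQ]
      nlinarith [hFL (x (k + 1)),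
        mul_le_mul_of_nonneg_left ih (mul_nonneg (hη k).1 (hQpos k).le)]
  refine summable_of_mul_le_sub_succ hω (fun k => ?_) hCL fun k => ?_
  · have := hQpos (k + 1)
    positivity
  · have hdiff : C k 0 - C (k + 1) 0 = (C k 0 - F 0 (x (k + 1))) / Q (k + 1) := by
      have := (hQpos (k + 1)).ne'
      rw [hC]
      field_simp
      rw [hQ]
      ring
    rw [hdiff, le_div_iff₀ (hQpos _)]
    refine le_of_eq_of_le ?_ (hdec k 0)
    have := (hQpos (k + 1)).ne'
    field_simp
end

section
/- (Global convergence of the max-type nonmonotone multiobjective memory gradient algorithm.) Let F : ℝⁿ → ℝᵐ be continuously differentiable with each ∇Fᵢ Lipschitz continuous with constant L > 0 and each Fᵢ bounded from below; let ψ(x,d) = max_{1≤i≤m} ⟨∇Fᵢ(x), d⟩ and v(x) the unique minimizer over d of ψ(x,d) + ½‖d‖². Let ρ ∈ (0,1), 0 < λ₁ ≤ λ₂, 0 < λ₃ ≤ λ₄ ≤ 1, M a nonnegative integer with M(k) = min(k, M), and let (xₖ), (dₖ), (αₖ) satisfy: x_{k+1} = xₖ + αₖ dₖ; no xₖ is Pareto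 critical; there are constants c > 0 and ξ₁, ξ₂ > 0 with ψ(xₖ,dₖ) ≤ c·ψ(xₖ,v(xₖ)), ‖v(xₖ)‖ ≤ ξ₁ and ‖dₖ‖ ≤ ξ₂ for all k; the max-type Armijo condition Fᵢ(xₖ + αₖ dₖ) ≤ max_{0≤j≤M(k)} Fᵢ(x_{k−j}) + ρ αₖ ψ(xₖ,dₖ) holds for all i; and either αₖ ∈ [λ₁, λ₂] or there exists σ ∈ [λ₃, λ₄] such that the trial step αₖ/σ violates the max-type Armijo condition for some index i. Then lim inf_{k→∞} ‖v(xₖ)‖ = 0. -/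
open scoped RealInnerProductSpace

/-- Maximum of past function values over the memory window `{k-j : 0 ≤ j ≤ min k M}`. -/
noncomputable def maxPast {n m : ℕ} (F : Fin m → EuclideanSpace ℝ (Fin n) → ℝ)
    (x : ℕ → EuclideanSpace ℝ (Fin n)) (M k : ℕ) (i : Fin m) : ℝ :=
  (Finset.range (min k M + 1)).sup' (Finset.nonempty_range_iff.mpr (Nat.succ_ne_zero _))
    fun j => F i (x (k - j))

theorem inner_gradient_le_psi {n m : ℕ} [NeZero m] (F : Fin m → EuclideanSpace ℝ (Fin n) → ℝ)
    (x d : EuclideanSpace ℝ (Fin n)) (i : Fin m) : ⟪gradient (F i) x, d⟫ ≤ psi F x d :=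
  Finset.le_sup' (fun i => ⟪gradient (F i) x, d⟫) (Finset.mem_univ i)

theorem le_maxPast {n m : ℕ} (F : Fin m → EuclideanSpace ℝ (Fin n) → ℝ)
    (x : ℕ → EuclideanSpace ℝ (Fin n)) (M k : ℕ) (i : Fin m) :
    F i (x k) ≤ maxPast F x M k i :=
  Finset.le_sup' (fun j => F i (x (k - j))) (Finset.mem_range.mpr (Nat.succ_pos (min k M)))

theorem maxPast_le {n m : ℕ} {F : Fin m → EuclideanSpace ℝ (Fin n) → ℝ}
    {x : ℕ → EuclideanSpace ℝ (Fin n)} {M k : ℕ} {i : Fin m} {C : ℝ}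
    (h : ∀ l, l ≤ k → k ≤ l + M → F i (x l) ≤ C) : maxPast F x M k i ≤ C := by
  refine Finset.sup'_le _ _ fun j hj => h _ (Nat.sub_le _ _) ?_
  have := Finset.mem_range.mp hj
  omega

/-- A quadratic upper bound for a function with Lipschitz gradient. -/
theorem le_add_inner_gradient_of_lipschitz {E : Type*} [NormedAddCommGroup E]
    [InnerProductSpace ℝ E] [CompleteSpace E] {f : E → ℝ} (hf : Differentiable ℝ f)
    {L : ℝ} (hL : 0 ≤ L) (hLip : LipschitzWith L.toNNReal (fun y => gradient f y)) (x h : E) :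
    f (x + h) ≤ f x + ⟪gradient f x, h⟫ + L * ‖h‖ ^ 2 := by
  have key := (convex_closedBall x ‖h‖).norm_image_sub_le_of_norm_hasFDerivWithin_le'
    (f := f) (f' := fun y => InnerProductSpace.toDual ℝ E (gradient f y))
    (φ := InnerProductSpace.toDual ℝ E (gradient f x)) (C := L * ‖h‖) (x := x) (y := x + h)
    (fun y _ => (hf y).hasGradientAt.hasFDerivAt.hasFDerivWithinAt)
    (fun y hy => by
      rw [← map_sub, LinearIsometryEquiv.norm_map, ← dist_eq_norm]
      refine (hLip.dist_le_mul y x).trans ?_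
      rw [Real.coe_toNNReal _ hL]
      exact mul_le_mul_of_nonneg_left (Metric.mem_closedBall.mp hy) hL)
    (Metric.mem_closedBall_self (norm_nonneg _)) (by simp)
  rw [add_sub_cancel_left, InnerProductSpace.toDual_apply_apply, Real.norm_eq_abs] at key
  nlinarith [le_abs_self (f (x + h) - f x - ⟪gradient f x, h⟫)]

/-- A step violating the Armijo inequality at a direction of descent is bounded below. -/
theorem le_of_armijo_violation {E : Type*} [NormedAddCommGroup E]
    [InnerProductSpace ℝ E] [CompleteSpace E] {f : E → ℝ} (hf : Differentiable ℝ f)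
    {L : ℝ} (hL : 0 < L) (hLip : LipschitzWith L.toNNReal (fun y => gradient f y)) {x d : E}
    {ρ t p ξ δ : ℝ} (hρ : ρ < 1) (ht : 0 < t) (hξ : 0 < ξ) (hd : ‖d‖ ≤ ξ)
    (hp : ⟪gradient f x, d⟫ ≤ p) (hpδ : p ≤ -δ) (hviol : f x + ρ * t * p < f (x + t • d)) :
    (1 - ρ) * δ / (L * ξ ^ 2) ≤ t := by
  have h1 := le_add_inner_gradient_of_lipschitz hf hL.le hLip x (t • d)
  rw [real_inner_smul_right, norm_smul, Real.norm_of_nonneg ht.le] at h1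
  have h2 : ‖d‖ ^ 2 ≤ ξ ^ 2 := pow_le_pow_left₀ (norm_nonneg _) hd 2
  have h3 : L * (t * ‖d‖) ^ 2 ≤ t * (L * t * ξ ^ 2) := by
    have := mul_le_mul_of_nonneg_left h2 (by positivity : 0 ≤ L * t ^ 2)
    linarith
  have h4 : t * ⟪gradient f x, d⟫ ≤ t * p := mul_le_mul_of_nonneg_left hp ht.le
  have h5 : t * (ρ * p) < t * (p + L * t * ξ ^ 2) := by linarith
  have h6 : ρ * p < p + L * t * ξ ^ 2 := lt_of_mul_lt_mul_left h5 ht.le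
  rw [div_le_iff₀ (by positivity)]
  nlinarith

/-- A sequence of objective values that eventually drops by a fixed amount below the maximum
over a sliding window is unbounded below. -/
theorem not_bddBelow_of_le_maxPast_sub {n m : ℕ} {F : Fin m → EuclideanSpace ℝ (Fin n) → ℝ}
    {x : ℕ → EuclideanSpace ℝ (Fin n)} {M : ℕ} {i : Fin m} {η : ℝ} {K : ℕ} (hη : 0 < η)
    (hle : ∀ k, F i (x (k + 1)) ≤ maxPast F x M k i)
    (hdrop : ∀ k, K ≤ k → F i (x (k + 1)) ≤ maxPast F x M k i - η) :
    ¬ BddBelow (Set.range (F i)) := by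
  rintro ⟨b, hb⟩
  have h0 : ∀ k, F i (x k) ≤ F i (x 0) := by
    intro k
    induction k using Nat.strong_induction_on with
    | _ k ih =>
      cases k with
      | zero => exact le_rfl
      | succ k => exact (hle k).trans (maxPast_le fun l hl _ => ih l (Nat.lt_succ_of_le hl))
  have hp : ∀ p : ℕ, ∃ N, K ≤ N ∧ ∀ k, N ≤ k → F i (x k) ≤ F i (x 0) - p * η := by
    intro p
    induction p with
    | zero => exact ⟨K, le_rfl, fun k _ => by simpa using h0 k⟩
    | succ p ih =>
      obtain ⟨N, hKN, hN⟩ := ih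
      refine ⟨N + M + 1, by omega, fun k hk => ?_⟩
      obtain ⟨k, rfl⟩ : ∃ l, k = l + 1 := ⟨k - 1, by omega⟩
      have h1 := hdrop k (by omega)
      have h2 : maxPast F x M k i ≤ F i (x 0) - p * η :=
        maxPast_le fun l _ hl => hN l (by omega)
      push_cast
      linarith
  obtain ⟨p, hpη⟩ := exists_nat_gt ((F i (x 0) - b) / η)
  rw [div_lt_iff₀ hη] at hpη
  obtain ⟨N, -, hN⟩ := hp p
  have h1 := hN N le_rfl
  have h2 := hb (Set.mem_range_self (x N))
  linarith

theorem stmt17 {n m : ℕ} [NeZero m]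
    (F : Fin m → EuclideanSpace ℝ (Fin n) → ℝ)
    (hF : ∀ i, ContDiff ℝ 1 (F i))
    (L : ℝ) (hL : 0 < L)
    (hLip : ∀ i, LipschitzWith L.toNNReal (fun y => gradient (F i) y))
    (hbdd : ∀ i, BddBelow (Set.range (F i)))
    (v : EuclideanSpace ℝ (Fin n) → EuclideanSpace ℝ (Fin n))
    (hv : ∀ x d, psi F x (v x) + ‖v x‖ ^ 2 / 2 ≤ psi F x d + ‖d‖ ^ 2 / 2)
    (ρ lam1 lam2 lam3 lam4 : ℝ) (hρ : ρ ∈ Set.Ioo (0 : ℝ) 1)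
    (hlam1 : 0 < lam1) (hlam1₂ : lam1 ≤ lam2) (hlam3 : 0 < lam3) (hlam3₄ : lam3 ≤ lam4) (hlam4 : lam4 ≤ 1)
    (M : ℕ)
    (x d : ℕ → EuclideanSpace ℝ (Fin n)) (α : ℕ → ℝ) (hα : ∀ k, 0 < α k)
    (hstep : ∀ k, x (k + 1) = x k + α k • d k)
    (hncrit : ∀ k, ∃ dd, psi F (x k) dd < 0)
    (c ξ₁ ξ₂ : ℝ) (hc : 0 < c) (hξ₁ : 0 < ξ₁) (hξ₂ : 0 < ξ₂)
    (hsd : ∀ k, psi F (x k) (d k) ≤ c * psi F (x k) (v (x k)))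
    (hvb : ∀ k, ‖v (x k)‖ ≤ ξ₁) (hdb : ∀ k, ‖d k‖ ≤ ξ₂)
    (hArm : ∀ k i, F i (x k + α k • d k) ≤
      maxPast F x M k i + ρ * α k * psi F (x k) (d k))
    (halt : ∀ k, (lam1 ≤ α k ∧ α k ≤ lam2) ∨
      ∃ σ, lam3 ≤ σ ∧ σ ≤ lam4 ∧ ∃ i, F i (x k + (α k / σ) • d k) >
        maxPast F x M k i + ρ * (α k / σ) * psi F (x k) (d k)) :
    Filter.liminf (fun k => ‖v (x k)‖) Filter.atTop = 0 := by
  have hpsiv : ∀ k, psi F (x k) (v (x k)) ≤ -(‖v (x k)‖ ^ 2 / 2) := fun k => by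
    have := hv (x k) 0
    rw [psi_zero, norm_zero] at this
    linarith
  have hpsid : ∀ k, psi F (x k) (d k) ≤ -(c * (‖v (x k)‖ ^ 2 / 2)) := fun k => by
    have := mul_le_mul_of_nonneg_left (hpsiv k) hc.le
    linarith [hsd k]
  have hbddv : Filter.IsBoundedUnder (· ≤ ·) Filter.atTop fun k => ‖v (x k)‖ :=
    Filter.isBoundedUnder_of ⟨ξ₁, hvb⟩
  have hbddv' : Filter.IsBoundedUnder (· ≥ ·) Filter.atTop fun k => ‖v (x k)‖ :=
    Filter.isBoundedUnder_of ⟨0, fun k => norm_nonneg _⟩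
  refine le_antisymm ?_ (Filter.le_liminf_of_le hbddv.isCoboundedUnder_ge
    (Filter.Eventually.of_forall fun k => norm_nonneg _))
  by_contra! hpos
  obtain ⟨ε, hε, hεlt⟩ := exists_between hpos
  obtain ⟨K, hK⟩ :=
    Filter.eventually_atTop.mp (Filter.eventually_lt_of_lt_liminf hεlt hbddv')
  set δ : ℝ := c * (ε ^ 2 / 2) with hδ
  have hδpos : 0 < δ := by positivity
  have hpsiδ : ∀ k, K ≤ k → psi F (x k) (d k) ≤ -δ := fun k hk => by
    have h1 : ε ^ 2 ≤ ‖v (x k)‖ ^ 2 := pow_le_pow_left₀ hε.le (hK k hk).le 2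
    have h2 : δ ≤ c * (‖v (x k)‖ ^ 2 / 2) := mul_le_mul_of_nonneg_left (by linarith) hc.le
    linarith [hpsid k]
  have hρ' : 0 < 1 - ρ := sub_pos.mpr hρ.2
  set t₀ : ℝ := (1 - ρ) * δ / (L * ξ₂ ^ 2) with ht₀
  have ht₀pos : 0 < t₀ := by positivity
  set a : ℝ := min lam1 (lam3 * t₀) with ha
  have hapos : 0 < a := lt_min hlam1 (by positivity)
  have hαa : ∀ k, K ≤ k → a ≤ α k := fun k hk => by
    rcases halt k with h | ⟨σ, hσ3, -, i, hi⟩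
    · exact (min_le_left _ _).trans h.1
    · have hσ : 0 < σ := hlam3.trans_le hσ3
      have h1 : t₀ ≤ α k / σ :=
        le_of_armijo_violation ((hF i).differentiable one_ne_zero) hL (hLip i) hρ.2
          (div_pos (hα k) hσ) hξ₂ (hdb k) (inner_gradient_le_psi F (x k) (d k) i) (hpsiδ k hk)
          (lt_of_le_of_lt (by linarith [le_maxPast F x M k i]) hi)
      rw [le_div_iff₀ hσ] at h1
      have h2 : lam3 * t₀ ≤ σ * t₀ := mul_le_mul_of_nonneg_right hσ3 ht₀pos.le
      exact (min_le_right _ _).trans (by linarith)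
  refine not_bddBelow_of_le_maxPast_sub (x := x) (M := M) (K := K) (i := 0)
    (η := ρ * (a * δ)) (mul_pos hρ.1 (mul_pos hapos hδpos)) (fun k => ?_) (fun k hk => ?_)
    (hbdd 0)
  · have h1 := hArm k 0
    have h2 : psi F (x k) (d k) ≤ 0 := (hpsid k).trans (neg_nonpos.mpr (by positivity))
    have h3 := mul_nonpos_of_nonneg_of_nonpos (mul_pos hρ.1 (hα k)).le h2
    rw [hstep k]
    linarith
  · have h1 := hArm k 0
    have h2 : a * δ ≤ α k * -psi F (x k) (d k) :=
      mul_le_mul (hαa k hk) (by linarith [hpsiδ k hk]) hδpos.le (hα k).le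
    have h3 := mul_le_mul_of_nonneg_left h2 hρ.1.le
    rw [hstep k]
    linarith
end
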